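/- arXiv:math/0607061 — 2 statements merged into one kernel-verified Lean document; each statement's English description precedes it below -/
import Mathlib

section
/- Fix q ∈ ℂ with 0 < |q| < 1, η ∈ ℂ with η ≠ 0, an integer k ≥ 1, and n ∈ ℤ. Let g : ℂ → ℂ be holomorphic on ℂ∖{0}, set F(z) = η^{−k} z^{−k} g(qz) − g(z), and let c_j(F) = (2πi)^{−1} ∮_{|z|=1} F(z) z^{−j−1} dz denote the j-th Laurent coefficient of F. Then the series Σ_{l∈ℤ} q^{nl} q^{kl(l+1)/2} η^{−kl} c_{kl+n}(F) converges absolutely and equals 0. (That is, the functional θ^k_n(η^{−1}) = Σ_{l∈ℤ} q^{nl} q^{kl(l+1)/2} η^{−kl} φ_{kl+n}, where φ_j extracts the j-th Laurent coefficient, vanishes on the image of the operator g ↦ F.) -/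
/-- The `j`-th Laurent coefficient of a function on `ℂ ∖ {0}`:
`c_j(f) = (2πi)⁻¹ ∮_{|z|=1} f(z) z^{−j−1} dz`. -/
noncomputable def laurentCoeff (f : ℂ → ℂ) (j : ℤ) : ℂ :=
  (2 * (Real.pi : ℂ) * Complex.I)⁻¹ * ∮ z in C(0, 1), f z * z ^ (-j - 1)

lemma aux_summable (q η : ℂ) (hq0 : 0 < ‖q‖)
    (hq1 : ‖q‖ < 1) (hη : η ≠ 0) (k : ℤ) (hk : 1 ≤ k) (n : ℤ) :
    Summable (fun l : ℤ =>
      ‖q ^ (n * l) * q ^ (k * (l * (l + 1)) / 2) * η ^ (-(k * l))‖) := by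
  have hq : q ≠ 0 := norm_pos_iff.mp hq0
  have hpi : (Real.pi : ℂ) ≠ 0 := by exact_mod_cast Real.pi_ne_zero
  set L := Complex.log q with hL
  set M := Complex.log η with hM
  have hLq : Complex.exp L = q := Complex.exp_log hq
  have hMη : Complex.exp M = η := Complex.exp_log hη
  have hτ : 0 < ((-Complex.I) * ((k / (2 * Real.pi) : ℝ) : ℂ) * L).im := by
    have h1 : L.re < 0 := by
      rw [hL, Complex.log_re]; exact Real.log_neg hq0 hq1
    have hk' : (0:ℝ) < k := by exact_mod_cast hk
    have h2 : (0:ℝ) < k / (2 * Real.pi) := by positivity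
    have : ((-Complex.I) * ((k / (2 * Real.pi) : ℝ) : ℂ) * L).im = -((k / (2 * Real.pi)) * L.re) := by
      rw [mul_assoc, neg_mul, Complex.neg_im, Complex.I_mul_im, Complex.re_ofReal_mul]
    rw [this]
    nlinarith [mul_pos h2 (neg_pos.mpr h1)]
  have hs := (summable_jacobiTheta₂_term_iff
    ((n * L + k * L / 2 - k * M) / (2 * Real.pi * Complex.I)) _).mpr hτ
  refine hs.norm.congr fun l => ?_
  congr 1
  rw [jacobiTheta₂_term]
  obtain ⟨m, hm⟩ := (Int.even_mul_succ_self l)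
  have hm2 : k * (l * (l + 1)) / 2 = k * m := by
    rw [hm, show k * (m + m) = (k * m) * 2 by ring]; simp
  have hmc : (l : ℂ) * (l + 1) = 2 * m := by
    have : l * (l+1) = 2 * m := by rw [hm]; ring
    exact_mod_cast this
  rw [hm2]
  have e : ∀ j : ℤ, q ^ j = Complex.exp (j * L) := fun j => by
    rw [Complex.exp_int_mul, hLq]
  have e' : ∀ j : ℤ, η ^ j = Complex.exp (j * M) := fun j => by
    rw [Complex.exp_int_mul, hMη]
  rw [e, e, e', ← Complex.exp_add, ← Complex.exp_add]
  congr 1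
  push_cast
  have hI := Complex.I_sq
  have a1 : 2 * (Real.pi : ℂ) * Complex.I * l * ((n * L + k * L / 2 - k * M) / (2 * Real.pi * Complex.I))
      = l * (n * L + k * L / 2 - k * M) := by
    field_simp [Complex.I_ne_zero]
  have a2 : (Real.pi : ℂ) * Complex.I * (l:ℂ) ^ 2 * (-Complex.I * (k / (2 * Real.pi)) * L)
      = l ^ 2 * (k / 2) * L := by
    have : (Real.pi : ℂ) * Complex.I * (l:ℂ) ^ 2 * (-Complex.I * (k / (2 * Real.pi)) * L)
      = -Complex.I ^ 2 * (l ^ 2 * (k / 2) * L) := by field_simp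
    rw [this, hI]; ring
  rw [a1, a2]
  linear_combination (k * L / 2) * hmc

lemma aux_rot (f : ℂ → ℂ) (r a : ℝ) (hr : r ≠ 0) :
    (∮ z in C(0, 1), (r * Complex.exp (a * Complex.I)) * f ((r * Complex.exp (a * Complex.I)) * z))
      = ∮ z in C(0, r), f z := by
  have hm : ∀ θ : ℝ, circleMap 0 r (θ + a) = (r * Complex.exp (a * Complex.I)) * circleMap 0 1 θ := by
    intro θ
    simp only [circleMap]
    push_cast
    rw [add_mul, Complex.exp_add]; ring
  have hper : Function.Periodic (fun θ => deriv (circleMap 0 r) θ • f (circleMap 0 r θ)) (2 * Real.pi) := by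
    intro θ
    simp [deriv_circleMap, periodic_circleMap 0 r θ]
  have h := hper.intervalIntegral_add_eq 0 a
  rw [circleIntegral, circleIntegral]
  rw [zero_add] at h
  rw [h]
  have h2 := intervalIntegral.integral_comp_add_right (a := 0) (b := 2 * Real.pi)
    (fun θ => deriv (circleMap 0 r) θ • f (circleMap 0 r θ)) a
  rw [zero_add, add_comm _ a] at h2
  rw [← h2]
  congr 1
  ext θ
  simp only [deriv_circleMap, smul_eq_mul, hm]
  ring

lemma aux_annulus (h : ℂ → ℂ) (hh : ∀ z : ℂ, z ≠ 0 → DifferentiableAt ℂ h z) (r : ℝ)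
    (hr : 0 < r) (hr1 : r ≤ 1) : (∮ z in C(0, 1), h z) = ∮ z in C(0, r), h z := by
  have := Complex.circleIntegral_eq_of_differentiable_on_annulus_off_countable (c := 0) (f := h)
    hr hr1 (s := ∅) Set.countable_empty
    (fun z hz => (hh z (by rintro rfl; simp [hr] at hz)).continuousAt.continuousWithinAt)
    (fun z hz => hh z (by rintro rfl; simp [hr.le] at hz))
  exact this

lemma aux_scale (q : ℂ) (hq0 : 0 < ‖q‖) (hq1 : ‖q‖ < 1) (g : ℂ → ℂ)
    (hg : ∀ z : ℂ, z ≠ 0 → DifferentiableAt ℂ g z) (j : ℤ) :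
    laurentCoeff (fun z => g (q * z)) j = q ^ j * laurentCoeff g j := by
  have hq : q ≠ 0 := norm_pos_iff.mp hq0
  have h1 := aux_annulus (fun z => g z * z ^ (-j - 1))
    (fun z hz => (hg z hz).mul (differentiableAt_zpow.mpr (Or.inl hz))) ‖q‖ hq0 hq1.le
  have h2 := aux_rot (fun z => g z * z ^ (-j - 1)) ‖q‖ q.arg hq0.ne'
  rw [Complex.norm_mul_exp_arg_mul_I, ← h1] at h2
  rw [laurentCoeff, laurentCoeff, ← h2, mul_left_comm, ← circleIntegral.integral_const_mul (q ^ j)]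
  congr 2
  ext z
  rw [mul_zpow]
  have : q ^ j * (q * q ^ (-j - 1)) = 1 := by
    rw [← zpow_one_add₀ hq, ← zpow_add₀ hq]; simp
  linear_combination (- g (q * z) * z ^ (-j - 1)) * this

lemma aux_coeff (q η : ℂ) (hq0 : 0 < ‖q‖)
    (hq1 : ‖q‖ < 1) (k : ℤ) (g : ℂ → ℂ)
    (hg : ∀ z : ℂ, z ≠ 0 → DifferentiableAt ℂ g z)
    (F : ℂ → ℂ) (hF : ∀ z : ℂ, F z = η ^ (-k) * z ^ (-k) * g (q * z) - g z) (j : ℤ) :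
    laurentCoeff F j = η ^ (-k) * q ^ (j + k) * laurentCoeff g (j + k) - laurentCoeff g j := by
  have hq : q ≠ 0 := norm_pos_iff.mp hq0
  rw [mul_assoc, ← aux_scale q hq0 hq1 g hg]
  simp only [laurentCoeff]
  have hne : ∀ z ∈ Metric.sphere (0:ℂ) 1, z ≠ 0 := by
    rintro z hz rfl; simp at hz
  rw [mul_left_comm, ← mul_sub, ← circleIntegral.integral_const_mul (η ^ (-k)),
    ← circleIntegral.integral_sub]
  · congr 1
    refine circleIntegral.integral_congr zero_le_one fun z hz => ?_
    have hz0 := hne z hz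
    simp only [hF]
    rw [show -(j + k) - 1 = -k + (-j - 1) by ring, zpow_add₀ hz0]
    ring
  · refine ContinuousOn.circleIntegrable zero_le_one fun z hz => ContinuousAt.continuousWithinAt ?_
    have hz0 := hne z hz
    have : ContinuousAt (fun z => g (q * z)) z :=
      ContinuousAt.comp (f := fun z => q * z) (hg _ (mul_ne_zero hq hz0)).continuousAt (by fun_prop)
    exact continuousAt_const.mul (this.mul (continuousAt_zpow₀ _ _ (Or.inl hz0)))
  · refine ContinuousOn.circleIntegrable zero_le_one fun z hz => ContinuousAt.continuousWithinAt ?_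
    have hz0 := hne z hz
    exact (hg _ hz0).continuousAt.mul (continuousAt_zpow₀ _ _ (Or.inl hz0))

lemma aux_bdd (g : ℂ → ℂ) (hg : ∀ z : ℂ, z ≠ 0 → DifferentiableAt ℂ g z) :
    ∃ C, ∀ j : ℤ, ‖laurentCoeff g j‖ ≤ C := by
  have hne : ∀ z ∈ Metric.sphere (0:ℂ) 1, z ≠ 0 := by
    rintro z hz rfl; simp at hz
  obtain ⟨C, hC⟩ := (isCompact_sphere (0:ℂ) 1).exists_bound_of_continuousOn
    (f := g) (fun z hz => (hg z (hne z hz)).continuousAt.continuousWithinAt)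
  refine ⟨‖(2 * (Real.pi : ℂ) * Complex.I)⁻¹‖ * (2 * Real.pi * 1 * C), fun j => ?_⟩
  rw [laurentCoeff, norm_mul]
  gcongr
  refine circleIntegral.norm_integral_le_of_norm_le_const zero_le_one fun z hz => ?_
  have : ‖z‖ = 1 := by simpa using hz
  rw [norm_mul, norm_zpow, this, one_zpow, mul_one]
  exact hC z hz


/-- For `0 < |q| < 1`, `η ≠ 0`, `k ≥ 1`, `n ∈ ℤ` and `g` holomorphic on `ℂ ∖ {0}`, with
`F(z) = η^{−k} z^{−k} g(qz) − g(z)`, the series `Σ_{l∈ℤ} q^{nl} q^{kl(l+1)/2} η^{−kl} c_{kl+n}(F)`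
converges absolutely and equals `0`: the functional `θ^k_n(η^{−1})` vanishes on the image
of the coboundary operator. -/
theorem theta_functional_vanishes_on_coboundaries (q η : ℂ) (hq0 : 0 < ‖q‖)
    (hq1 : ‖q‖ < 1) (hη : η ≠ 0) (k : ℤ) (hk : 1 ≤ k) (n : ℤ) (g : ℂ → ℂ)
    (hg : ∀ z : ℂ, z ≠ 0 → DifferentiableAt ℂ g z)
    (F : ℂ → ℂ) (hF : ∀ z : ℂ, F z = η ^ (-k) * z ^ (-k) * g (q * z) - g z) :
    Summable (fun l : ℤ =>
      ‖q ^ (n * l) * q ^ (k * (l * (l + 1)) / 2) * η ^ (-(k * l)) * laurentCoeff F (k * l + n)‖) ∧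
    ∑' l : ℤ,
      q ^ (n * l) * q ^ (k * (l * (l + 1)) / 2) * η ^ (-(k * l)) * laurentCoeff F (k * l + n)
      = 0 := by
  have hq : q ≠ 0 := norm_pos_iff.mp hq0
  set A : ℤ → ℂ := fun l => q ^ (n * l) * q ^ (k * (l * (l + 1)) / 2) * η ^ (-(k * l)) with hA
  set B : ℤ → ℂ := fun l => A l * laurentCoeff g (k * l + n) with hB
  obtain ⟨C, hC⟩ := aux_bdd g hg
  have hBs : Summable fun l => ‖B l‖ := by
    refine Summable.of_nonneg_of_le (fun _ => norm_nonneg _) (fun l => ?_)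
      ((aux_summable q η hq0 hq1 hη k hk n).mul_right C)
    rw [hB, norm_mul]
    exact mul_le_mul_of_nonneg_left (hC _) (norm_nonneg _)
  have hAs : ∀ l, A (l + 1) = A l * (η ^ (-k) * q ^ (k * l + n + k)) := by
    intro l
    have h2 : k * ((l + 1) * (l + 1 + 1)) / 2 = k * (l * (l + 1)) / 2 + k * (l + 1) := by
      rw [show k * ((l + 1) * (l + 1 + 1)) = k * (l * (l + 1)) + (k * (l + 1)) * 2 by ring]
      exact Int.add_mul_ediv_right _ _ two_ne_zero
    simp only [hA]
    rw [h2, show n * (l + 1) = n * l + n by ring, show -(k * (l + 1)) = -(k * l) + -k by ring,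
      show k * l + n + k = n + k * (l + 1) by ring, zpow_add₀ hq, zpow_add₀ hq, zpow_add₀ hη,
      zpow_add₀ hq]
    ring
  have key : ∀ l : ℤ, q ^ (n * l) * q ^ (k * (l * (l + 1)) / 2) * η ^ (-(k * l)) *
      laurentCoeff F (k * l + n) = B (l + 1) - B l := by
    intro l
    rw [aux_coeff q η hq0 hq1 k g hg F hF]
    simp only [hB]
    rw [hAs, show k * (l + 1) + n = k * l + n + k by ring]
    simp only [hA]
    ring
  simp only [key]
  have hB1 : Summable fun l => ‖B (l + 1)‖ := (Equiv.addRight (1:ℤ)).summable_iff.mpr hBs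
  constructor
  · exact Summable.of_nonneg_of_le (fun _ => norm_nonneg _) (fun l => norm_sub_le _ _) (hB1.add hBs)
  · rw [hB1.of_norm.tsum_sub hBs.of_norm, sub_eq_zero]
    exact (Equiv.addRight (1:ℤ)).tsum_eq B
end

section
/- Fix q ∈ ℂ with 0 < |q| < 1, η ∈ ℂ with η ≠ 0, and an integer k ≥ 1. Let f : ℂ → ℂ be holomorphic on ℂ∖{0} and suppose that ∮_{|z|=1} h(z) f(z) z^{−1} dz = 0 for every function h : ℂ → ℂ holomorphic on ℂ∖{0} satisfying η^k z^k h(qz) = h(z) for all z ≠ 0. Then there exists a function g : ℂ → ℂ holomorphic on ℂ∖{0} such that f(z) = η^{−k} z^{−k} g(qz) − g(z) for all z ≠ 0. -/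
open Complex Metric Set Filter Topology

def Rapid (a : ℤ → ℂ) : Prop :=
  ∀ R : ℝ, 1 ≤ R → ∃ C : ℝ, ∀ n : ℤ, ‖a n‖ * R ^ n.natAbs ≤ C

lemma summable_half : Summable (fun n : ℤ => (1/2 : ℝ) ^ n.natAbs) := by
  apply Summable.of_nat_of_neg
  · simpa using summable_geometric_two
  · simpa using summable_geometric_two

lemma zpow_le_natAbs {x M : ℝ} (hx : 0 < x) (h1 : x ≤ M) (h2 : x⁻¹ ≤ M) (n : ℤ) :
    x ^ n ≤ M ^ n.natAbs := by
  rcases Int.natAbs_eq n with h | h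
  · rw [h]; simp only [zpow_natCast, Int.natAbs_natCast]; gcongr
  · rw [h]; simp only [zpow_neg, zpow_natCast, Int.natAbs_neg, Int.natAbs_natCast, ← inv_pow]
    gcongr

lemma Rapid.bound {a : ℤ → ℂ} (ha : Rapid a) {M : ℝ} (hM : 1 ≤ M) :
    ∃ C : ℝ, ∀ z : ℂ, z ≠ 0 → ‖z‖ ≤ M → ‖z‖⁻¹ ≤ M → ∀ n : ℤ,
      ‖a n * z ^ n‖ ≤ C * (1/2 : ℝ) ^ n.natAbs := by
  obtain ⟨C, hC⟩ := ha (2 * M) (by linarith)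
  refine ⟨C, fun z hz h1 h2 n => ?_⟩
  have h := zpow_le_natAbs (norm_pos_iff.2 hz) h1 h2 n
  calc ‖a n * z ^ n‖ = ‖a n‖ * ‖z‖ ^ n := by simp
    _ ≤ ‖a n‖ * M ^ n.natAbs := by gcongr
    _ = (‖a n‖ * (2 * M) ^ n.natAbs) * (1/2 : ℝ) ^ n.natAbs := by
        rw [mul_assoc, ← mul_pow]; congr 2; ring
    _ ≤ C * (1/2 : ℝ) ^ n.natAbs := by gcongr; exact hC n

lemma Rapid.summable {a : ℤ → ℂ} (ha : Rapid a) {z : ℂ} (hz : z ≠ 0) :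
    Summable (fun n : ℤ => a n * z ^ n) := by
  obtain ⟨C, hC⟩ := ha.bound (M := max 1 (max ‖z‖ ‖z‖⁻¹)) (le_max_left _ _)
  exact Summable.of_norm_bounded (summable_half.mul_left C) (hC z hz (by simp) (by simp))

lemma Rapid.differentiableAt {a : ℤ → ℂ} (ha : Rapid a) {z : ℂ} (hz : z ≠ 0) :
    DifferentiableAt ℂ (fun z => ∑' n : ℤ, a n * z ^ n) z := by
  set M := max 1 (max ‖z‖ ‖z‖⁻¹) + 1 with hMdef
  have hz' := norm_pos_iff.2 hz
  have hM1 : 1 ≤ M := by have := le_max_left 1 (max ‖z‖ ‖z‖⁻¹); linarith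
  have hMz : ‖z‖ < M := by
    have := (le_max_left ‖z‖ ‖z‖⁻¹).trans (le_max_right 1 (max ‖z‖ ‖z‖⁻¹)); linarith
  have hMz' : ‖z‖⁻¹ < M := by
    have := (le_max_right ‖z‖ ‖z‖⁻¹).trans (le_max_right 1 (max ‖z‖ ‖z‖⁻¹)); linarith
  obtain ⟨C, hC⟩ := ha.bound hM1
  have hU : IsOpen {w : ℂ | M⁻¹ < ‖w‖ ∧ ‖w‖ < M} :=
    (isOpen_lt continuous_const continuous_norm).inter (isOpen_lt continuous_norm continuous_const)
  have h0 : ∀ w ∈ {w : ℂ | M⁻¹ < ‖w‖ ∧ ‖w‖ < M}, w ≠ 0 := by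
    intro w hw h
    have := hw.1
    rw [h, norm_zero] at this
    have : 0 < M⁻¹ := by positivity
    linarith
  refine (differentiableOn_tsum_of_summable_norm (summable_half.mul_left C) ?_ hU ?_).differentiableAt
    (hU.mem_nhds ⟨inv_lt_of_inv_lt₀ hz' hMz', hMz⟩)
  · intro n w hw
    exact ((differentiableAt_zpow.2 (Or.inl (h0 w hw))).const_mul _).differentiableWithinAt
  · intro n w hw
    exact hC w (h0 w hw) hw.2.le (inv_le_of_inv_le₀ (by linarith) hw.1.le) n

noncomputable def lc (f : ℂ → ℂ) (n : ℤ) : ℂ :=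
  (2 * Real.pi * I : ℂ)⁻¹ • ∮ z in C(0, 1), z⁻¹ * (z ^ (-n) * f z)

lemma diff_aux {f : ℂ → ℂ} (hf : ∀ z : ℂ, z ≠ 0 → DifferentiableAt ℂ f z) (n : ℤ)
    {z : ℂ} (hz : z ≠ 0) : DifferentiableAt ℂ (fun z => z ^ (-n) * f z) z :=
  (differentiableAt_zpow.2 (Or.inl hz)).mul (hf z hz)

lemma lc_radius {f : ℂ → ℂ} (hf : ∀ z : ℂ, z ≠ 0 → DifferentiableAt ℂ f z) (n : ℤ)
    {r : ℝ} (hr : 0 < r) :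
    lc f n = (2 * Real.pi * I : ℂ)⁻¹ • ∮ z in C(0, r), z⁻¹ * (z ^ (-n) * f z) := by
  have key : ∀ r R : ℝ, 0 < r → r ≤ R → (∮ z in C(0, R), z⁻¹ * (z ^ (-n) * f z))
      = ∮ z in C(0, r), z⁻¹ * (z ^ (-n) * f z) := by
    intro r R hr hrR
    have := circleIntegral_sub_center_inv_smul_eq_of_differentiable_on_annulus_off_countable
      (c := 0) hr hrR (f := fun z => z ^ (-n) * f z) (s := ∅) countable_empty ?_ ?_
    · simpa using this
    · intro z hz
      refine (diff_aux hf n ?_).continuousAt.continuousWithinAt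
      rintro rfl
      exact hz.2 (by simpa using hr)
    · intro z hz
      refine diff_aux hf n ?_
      rintro rfl
      exact hz.1.2 (by simpa using hr.le)
  unfold lc
  congr 1
  rcases le_total 1 r with h | h
  · exact (key 1 r one_pos h).symm
  · exact key r 1 hr h

lemma lc_bound {f : ℂ → ℂ} (hf : ∀ z : ℂ, z ≠ 0 → DifferentiableAt ℂ f z)
    {r : ℝ} (hr : 0 < r) : ∃ C : ℝ, ∀ n : ℤ, ‖lc f n‖ * r ^ n ≤ C := by
  obtain ⟨C, hC⟩ := (isCompact_sphere (0 : ℂ) r).exists_bound_of_continuousOn (f := f) (by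
    intro z hz
    refine (hf z ?_).continuousAt.continuousWithinAt
    rintro rfl
    simp at hz; exact hr.ne hz)
  refine ⟨C, fun n => ?_⟩
  rw [lc_radius hf n hr]
  have := circleIntegral.norm_two_pi_i_inv_smul_integral_le_of_norm_le_const (c := 0) (R := r)
    (f := fun z => z⁻¹ * (z ^ (-n) * f z)) (C := r⁻¹ * (r ^ (-n) * C)) hr.le (by
    intro z hz
    have hz' : ‖z‖ = r := by simpa using hz
    rw [norm_mul, norm_mul, norm_inv, norm_zpow, hz']
    have := hC z hz
    gcongr)
  calc _ ≤ r * (r⁻¹ * (r ^ (-n) * C)) * r ^ n := by gcongr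
    _ = C := by rw [zpow_neg]; field_simp

lemma lc_rapid {f : ℂ → ℂ} (hf : ∀ z : ℂ, z ≠ 0 → DifferentiableAt ℂ f z) : Rapid (lc f) := by
  intro R hR
  have hR0 : 0 < R := by linarith
  obtain ⟨C1, h1⟩ := lc_bound hf hR0
  obtain ⟨C2, h2⟩ := lc_bound hf (inv_pos.2 hR0)
  refine ⟨max C1 C2, fun n => ?_⟩
  rcases Int.natAbs_eq n with h | h
  · refine le_trans (le_of_eq ?_) ((h1 n).trans (le_max_left _ _))
    congr 1; conv_rhs => rw [h, zpow_natCast]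
  · refine le_trans (le_of_eq ?_) ((h2 n).trans (le_max_right _ _))
    congr 1; conv_rhs => rw [h, zpow_neg, zpow_natCast, inv_pow, inv_inv]

lemma laurent {f : ℂ → ℂ} (hf : ∀ z : ℂ, z ≠ 0 → DifferentiableAt ℂ f z) {z : ℂ} (hz : z ≠ 0) :
    HasSum (fun n : ℤ => lc f n * z ^ n) (f z) := by
  have hr : 0 < ‖z‖ := norm_pos_iff.2 hz
  set r := ‖z‖ with hrdef
  have : Fact (0 < 2 * Real.pi) := ⟨Real.two_pi_pos⟩
  let F : C(AddCircle (2 * Real.pi), ℂ) := ⟨fun t => f (r * (AddCircle.toCircle t : ℂ)), by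
    rw [continuous_iff_continuousAt]
    intro t
    refine ContinuousAt.comp (f := fun t : AddCircle (2 * Real.pi) =>
      (r * (AddCircle.toCircle t : ℂ))) (g := f) (hf _ ?_).continuousAt ?_
    · simp [hr.ne']
    · have := AddCircle.continuous_toCircle (T := 2 * Real.pi)
      fun_prop⟩
  have hF : ∀ x : ℝ, F x = f (circleMap 0 r x) := by
    intro x
    simp [F, AddCircle.toCircle_apply_mk, circleMap]
  have hfour : ∀ (n : ℤ) (x : ℝ), (fourier n (x : AddCircle (2 * Real.pi)) : ℂ) = exp (x * I) ^ n := by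
    intro n x
    rw [fourier_coe_apply, ← Complex.exp_int_mul]
    congr 1
    have : (Real.pi : ℂ) ≠ 0 := by simp
    push_cast
    field_simp
  have hcoef : ∀ n : ℤ, fourierCoeff F n = lc f n * (r : ℂ) ^ n := by
    intro n
    have hrc : (r : ℂ) ≠ 0 := by exact_mod_cast hr.ne'
    rw [fourierCoeff_eq_intervalIntegral _ n 0, lc_radius hf n hr, circleIntegral, smul_eq_mul,
      ← intervalIntegral.integral_smul, ← intervalIntegral.integral_const_mul,
      ← intervalIntegral.integral_mul_const, zero_add]
    refine intervalIntegral.integral_congr fun x _ => ?_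
    simp only [hF, hfour, deriv_circleMap, smul_eq_mul]
    have hp : (Real.pi : ℂ) ≠ 0 := by simp
    have he := Complex.exp_ne_zero (x * I)
    have hI := I_ne_zero
    have : circleMap 0 r x = r * exp (x * I) := by simp [circleMap]
    generalize hcc : f (circleMap 0 r x) = y
    rw [this, mul_zpow, real_smul]
    simp only [zpow_neg]
    push_cast
    field_simp
  have hs : Summable (fourierCoeff F) := by
    have := (lc_rapid hf).summable (z := (r : ℂ)) (by exact_mod_cast hr.ne')
    exact this.congr fun n => (hcoef n).symm
  have := has_pointwise_sum_fourier_series_of_summable hs (arg z : AddCircle (2 * Real.pi))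
  have hzz : (r : ℂ) * exp (arg z * I) = z := norm_mul_exp_arg_mul_I z
  rw [hF] at this
  convert this using 1
  · ext n
    rw [hcoef, hfour, smul_eq_mul, mul_assoc, ← mul_zpow, hzz]
  · simp [circleMap, hzz]

lemma pairing_hasSum {f : ℂ → ℂ} (hf : ∀ z : ℂ, z ≠ 0 → DifferentiableAt ℂ f z)
    {u : ℤ → ℂ} (hu : Rapid u)
    (h0 : (∮ z in C(0, 1), (∑' n : ℤ, u n * z ^ n) * f z * z⁻¹) = 0) :
    HasSum (fun n : ℤ => u n * lc f (-n)) 0 := by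
  have hne : ∀ z ∈ sphere (0 : ℂ) 1, z ≠ 0 := by
    rintro z hz rfl
    simp at hz
  have hfc : ContinuousOn f (sphere (0 : ℂ) 1) := fun z hz =>
    (hf z (hne z hz)).continuousAt.continuousWithinAt
  obtain ⟨M, hM⟩ := (isCompact_sphere (0 : ℂ) 1).exists_bound_of_continuousOn hfc
  obtain ⟨C, hC⟩ := hu.bound le_rfl
  have hcont : ∀ n : ℤ, ContinuousOn (fun z : ℂ => u n * z ^ n * f z * z⁻¹) (sphere 0 1) := by
    intro n z hz
    have hz0 := hne z hz
    exact ((((differentiableAt_zpow.2 (Or.inl hz0)).const_mul _).mul (hf z hz0)).mul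
      (differentiableAt_inv hz0)).continuousAt.continuousWithinAt
  have hunif := tendstoUniformlyOn_tsum (s := sphere (0 : ℂ) 1)
    (f := fun (n : ℤ) (z : ℂ) => u n * z ^ n * f z * z⁻¹)
    (summable_half.mul_left (C * M)) (by
      intro n z hz
      have hz1 : ‖z‖ = 1 := by simpa using hz
      have h1 := hC z (hne z hz) hz1.le (by simp [hz1]) n
      have h2 := hM z hz
      have h3 := (norm_nonneg _).trans h1
      rw [norm_mul, norm_mul, norm_inv, hz1, inv_one, mul_one]
      calc _ ≤ (C * (1/2) ^ n.natAbs) * M := by gcongr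
        _ = _ := by ring)
  have ht := hunif.tendsto_circleIntegral_of_continuousOn zero_le_one
    (Eventually.of_forall fun t => continuousOn_finsetSum _ fun n _ => hcont n)
  have e1 : (∮ z in C(0, 1), ∑' n : ℤ, u n * z ^ n * f z * z⁻¹) = 0 := by
    rw [← h0]
    congr 1
    ext z
    rw [tsum_mul_right, tsum_mul_right]
  have e2 : ∀ t : Finset ℤ, (∮ z in C(0, 1), ∑ n ∈ t, u n * z ^ n * f z * z⁻¹)
      = (2 * Real.pi * I) * ∑ n ∈ t, u n * lc f (-n) := by
    intro t
    rw [circleIntegral.integral_fun_sum (fun n _ => (hcont n).circleIntegrable zero_le_one),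
      Finset.mul_sum]
    refine Finset.sum_congr rfl fun n _ => ?_
    have hp : (2 * Real.pi * I : ℂ) ≠ 0 := two_pi_I_ne_zero
    rw [lc, smul_eq_mul, mul_left_comm, mul_inv_cancel_left₀ hp,
      ← circleIntegral.integral_const_mul]
    congr 1
    ext z
    rw [neg_neg]; ring
  rw [e1] at ht
  simp only [e2] at ht
  have hp : (2 * Real.pi * I : ℂ) ≠ 0 := two_pi_I_ne_zero
  have := ht.const_mul (2 * Real.pi * I : ℂ)⁻¹
  simp only [inv_mul_cancel_left₀ hp, mul_zero] at this
  exact this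

noncomputable def EE (D ρ : ℝ) (l : ℤ) : ℝ := (D * ρ ^ l.natAbs) ^ l.natAbs

lemma EE_bound {D ρ : ℝ} (hD : 0 ≤ D) (h0 : 0 < ρ) (h1 : ρ < 1) :
    ∃ C : ℝ, ∀ N : ℕ, (D * ρ ^ N) ^ N ≤ C := by
  have ht : Tendsto (fun N : ℕ => D * ρ ^ N) atTop (𝓝 (D * 0)) :=
    (tendsto_pow_atTop_nhds_zero_of_lt_one h0.le h1).const_mul D
  rw [mul_zero] at ht
  obtain ⟨N0, hN0⟩ := eventually_atTop.1 (ht.eventually_le_const one_pos)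
  refine ⟨max 1 D ^ N0, fun N => ?_⟩
  rcases le_total N0 N with h | h
  · exact (pow_le_one₀ (by positivity) (hN0 N h)).trans (one_le_pow₀ (le_max_left _ _))
  · calc (D * ρ ^ N) ^ N ≤ (max 1 D) ^ N := by
          gcongr
          refine le_trans ?_ (le_max_right 1 D)
          exact mul_le_of_le_one_right hD (pow_le_one₀ h0.le h1.le)
      _ ≤ _ := pow_le_pow_right₀ (le_max_left _ _) h

lemma EE_rapid {D ρ : ℝ} (hD : 0 ≤ D) (h0 : 0 < ρ) (h1 : ρ < 1) :
    Rapid (fun l => (EE D ρ l : ℂ)) := by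
  intro R hR
  obtain ⟨C, hC⟩ := EE_bound (D := D * R) (by positivity) h0 h1
  refine ⟨C, fun n => le_trans (le_of_eq ?_) (hC n.natAbs)⟩
  have : 0 ≤ EE D ρ n := by unfold EE; positivity
  rw [norm_real, Real.norm_of_nonneg this, EE, ← mul_pow]
  ring

lemma EE_summable {D ρ : ℝ} (hD : 0 ≤ D) (h0 : 0 < ρ) (h1 : ρ < 1) :
    Summable (EE D ρ) := by
  have := (EE_rapid hD h0 h1).summable one_ne_zero
  simp only [one_zpow, mul_one] at this
  exact_mod_cast this

noncomputable def cc (η p : ℂ) (k n : ℤ) : ℂ := η ^ (-n) * p ^ (n * (n + k))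

noncomputable def DD (η p : ℂ) (k : ℤ) : ℝ := max ‖η‖ ‖η‖⁻¹ * ‖p‖ ^ (-k)

lemma DD_nonneg (η p : ℂ) (k : ℤ) : 0 ≤ DD η p k := by
  unfold DD
  have : 0 ≤ max ‖η‖ ‖η‖⁻¹ := (norm_nonneg η).trans (le_max_left _ _)
  positivity

lemma cc_ne {η p : ℂ} (hη : η ≠ 0) (hp : p ≠ 0) (k n : ℤ) : cc η p k n ≠ 0 :=
  mul_ne_zero (zpow_ne_zero _ hη) (zpow_ne_zero _ hp)

lemma cc_rec {η p : ℂ} (hη : η ≠ 0) (hp : p ≠ 0) (k n : ℤ) :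
    cc η p k (n + k) = η ^ (-k) * (p ^ (2 * k)) ^ (n + k) * cc η p k n := by
  unfold cc
  rw [← zpow_mul, neg_add, zpow_add₀ hη,
    show (n + k) * (n + k + k) = 2 * k * (n + k) + n * (n + k) by ring, zpow_add₀ hp]
  ring

lemma cc_ratio {η p : ℂ} (hη : η ≠ 0) (hp : p ≠ 0) (hp1 : ‖p‖ < 1) {k : ℤ} (hk : 1 ≤ k)
    {m n : ℤ} (h : (m ≤ 0 ∧ n ≤ m) ∨ (0 ≤ m ∧ m ≤ n)) :
    ‖cc η p k n‖ ≤ ‖cc η p k m‖ * EE (DD η p k) ‖p‖ (n - m) := by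
  obtain ⟨l, rfl⟩ : ∃ l, n = m + l := ⟨n - m, by ring⟩
  have hp0 := norm_pos_iff.2 hp
  have hη0 := norm_pos_iff.2 hη
  rw [add_sub_cancel_left]
  have hml : 0 ≤ m * l := by
    rcases h with ⟨h1, h2⟩ | ⟨h1, h2⟩
    · exact mul_nonneg_of_nonpos_of_nonpos h1 (by linarith)
    · exact mul_nonneg h1 (by linarith)
  have hN : (l.natAbs : ℤ) = |l| := Int.natCast_natAbs l
  unfold cc EE DD
  rw [norm_mul, norm_mul, norm_zpow, norm_zpow, norm_zpow, norm_zpow, neg_add,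
    zpow_add₀ hη0.ne', mul_assoc (max _ _), mul_pow]
  have e1 : ‖η‖ ^ (-l) ≤ max ‖η‖ ‖η‖⁻¹ ^ l.natAbs := by
    have := zpow_le_natAbs hη0 (le_max_left ‖η‖ ‖η‖⁻¹) (le_max_right ‖η‖ ‖η‖⁻¹) (-l)
    rwa [Int.natAbs_neg] at this
  have e2 : ‖p‖ ^ ((m + l) * (m + l + k)) ≤
      ‖p‖ ^ (m * (m + k)) * (‖p‖ ^ (-k) * ‖p‖ ^ l.natAbs) ^ l.natAbs := by
    rw [← zpow_natCast ‖p‖, ← zpow_add₀ hp0.ne', ← zpow_natCast, ← zpow_mul, ← zpow_add₀ hp0.ne']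
    apply zpow_le_zpow_right_of_le_one₀ hp0 hp1.le
    rw [hN]
    have h1 : |l| * |l| = l * l := abs_mul_abs_self l
    have h2 : -|l| ≤ l := neg_abs_le l
    nlinarith
  calc _ ≤ ‖η‖ ^ (-m) * max ‖η‖ ‖η‖⁻¹ ^ l.natAbs *
        (‖p‖ ^ (m * (m + k)) * (‖p‖ ^ (-k) * ‖p‖ ^ l.natAbs) ^ l.natAbs) := by gcongr
    _ = _ := by ring

lemma cc_rapid {η p : ℂ} (hη : η ≠ 0) (hp : p ≠ 0) (hp1 : ‖p‖ < 1) {k : ℤ} (hk : 1 ≤ k) :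
    Rapid (cc η p k) := by
  intro R hR
  obtain ⟨C, hC⟩ := EE_rapid (DD_nonneg η p k) (norm_pos_iff.2 hp) hp1 R hR
  refine ⟨C, fun n => le_trans ?_ (hC n)⟩
  gcongr
  have := cc_ratio hη hp hp1 hk (m := 0) (n := n) (by omega)
  rw [norm_real]
  refine this.trans ((le_of_eq ?_).trans (le_abs_self _))
  simp [cc]

lemma Rapid.mono {a b : ℤ → ℂ} (ha : Rapid a) (h : ∀ n, ‖b n‖ ≤ ‖a n‖) : Rapid b := by
  intro R hR
  obtain ⟨C, hC⟩ := ha R hR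
  refine ⟨C, fun n => le_trans ?_ (hC n)⟩
  have := h n
  gcongr

lemma Rapid.comp_neg {a : ℤ → ℂ} (ha : Rapid a) : Rapid (fun n => a (-n)) := by
  intro R hR
  obtain ⟨C, hC⟩ := ha R hR
  refine ⟨C, fun n => ?_⟩
  have := hC (-n)
  rwa [Int.natAbs_neg] at this

set_option maxHeartbeats 1000000 in
/-- Nondegeneracy of the Serre pairing in the second variable: for `0 < |q| < 1`, `η ≠ 0`,
`k ≥ 1`, if `f` is holomorphic on `ℂ ∖ {0}` and `∮_{|z|=1} h(z) f(z) z⁻¹ dz = 0` for every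
`h` holomorphic on `ℂ ∖ {0}` with `η^k z^k h(qz) = h(z)`, then `f` is a coboundary:
`f(z) = η^{−k} z^{−k} g(qz) − g(z)` for some `g` holomorphic on `ℂ ∖ {0}`. -/
theorem serre_pairing_nondegenerate (q η : ℂ) (hq0 : 0 < ‖q‖) (hq1 : ‖q‖ < 1)
    (hη : η ≠ 0) (k : ℤ) (hk : 1 ≤ k) (f : ℂ → ℂ)
    (hf : ∀ z : ℂ, z ≠ 0 → DifferentiableAt ℂ f z)
    (hpair : ∀ h : ℂ → ℂ, (∀ z : ℂ, z ≠ 0 → DifferentiableAt ℂ h z) →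
      (∀ z : ℂ, z ≠ 0 → η ^ k * z ^ k * h (q * z) = h z) →
      (∮ z in C(0, 1), h z * f z * z⁻¹) = 0) :
    ∃ g : ℂ → ℂ, (∀ z : ℂ, z ≠ 0 → DifferentiableAt ℂ g z) ∧
      ∀ z : ℂ, z ≠ 0 → f z = η ^ (-k) * z ^ (-k) * g (q * z) - g z := by
  have hq : q ≠ 0 := norm_pos_iff.1 hq0
  obtain ⟨p, hpq⟩ : ∃ p : ℂ, p ^ (2 * k) = q := by
    obtain ⟨p, hp⟩ := IsAlgClosed.exists_pow_nat_eq q (n := 2 * k.toNat) (by omega)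
    refine ⟨p, ?_⟩
    rw [← hp, ← zpow_natCast]
    congr 1
    push_cast
    rw [Int.toNat_of_nonneg (by omega)]
  have hp : p ≠ 0 := by
    rintro rfl
    rw [zero_zpow _ (by omega)] at hpq
    exact hq hpq.symm
  have hp1 : ‖p‖ < 1 := by
    by_contra hcon
    rw [not_lt] at hcon
    have : 1 ≤ ‖p‖ ^ (2 * k) := one_le_zpow₀ hcon (by omega)
    rw [← norm_zpow, hpq] at this
    linarith
  set c := cc η p k with hc
  have hcne : ∀ n, c n ≠ 0 := cc_ne hη hp k
  have hcrec : ∀ n, c (n + k) = η ^ (-k) * q ^ (n + k) * c n := by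
    intro n; rw [hc, cc_rec hη hp, hpq]
  have hcr : Rapid c := cc_rapid hη hp hp1 hk
  set a := lc f with ha
  have har : Rapid a := lc_rapid hf
  have hsum : Summable (fun n => ‖c n * a n‖) := by
    obtain ⟨C, hC⟩ := har 1 le_rfl
    have h1 := (hcr.summable one_ne_zero).norm
    refine Summable.of_nonneg_of_le (fun _ => norm_nonneg _) (fun n => ?_) (h1.mul_right C)
    have := hC n
    rw [one_pow, mul_one] at this
    rw [one_zpow, mul_one, norm_mul]
    gcongr
  have hsumP : ∀ P : ℤ → Prop, ∀ [DecidablePred P],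
      Summable (fun n => if P n then c n * a n else 0) := by
    intro P _
    refine Summable.of_norm_bounded hsum fun n => ?_
    split_ifs
    · exact le_rfl
    · rw [norm_zero]; exact norm_nonneg _
  -- vanishing of all residue-class sums
  have hvan : ∀ m : ℤ, ∑' n : ℤ, (if k ∣ n - m then c n * a n else 0) = 0 := by
    intro m
    let u : ℤ → ℂ := fun n => if k ∣ n + m then c (-n) else 0
    have hu : Rapid u := hcr.comp_neg.mono fun n => by
      simp only [u]; split_ifs
      · exact le_rfl
      · simp
    have hurec : ∀ n, η ^ k * q ^ n * u n = u (n + k) := by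
      intro n
      have hiff : k ∣ n + k + m ↔ k ∣ n + m := by
        rw [show n + k + m = n + m + k by ring]; exact dvd_add_self_right
      simp only [u, hiff]
      split_ifs
      · have := hcrec (-(n + k))
        rw [show -(n + k) + k = -n by ring] at this
        rw [this, zpow_neg, zpow_neg]
        have h1 : η ^ k ≠ 0 := zpow_ne_zero _ hη
        have h2 : q ^ n ≠ 0 := zpow_ne_zero _ hq
        field_simp
      · simp
    have h0 := hpair (fun z => ∑' n : ℤ, u n * z ^ n) (fun z hz => hu.differentiableAt hz) (by
      intro z hz
      rw [← tsum_mul_left, ← (Equiv.addRight k).tsum_eq (fun n => u n * z ^ n)]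
      refine tsum_congr fun n => ?_
      rw [Equiv.coe_addRight, ← hurec, mul_zpow, zpow_add₀ hz]
      ring)
    have h1 := pairing_hasSum hf hu h0
    rw [← (Equiv.neg ℤ).tsum_eq]
    refine Eq.trans ?_ h1.tsum_eq
    refine tsum_congr fun n => ?_
    have hiff : k ∣ -n - m ↔ k ∣ n + m := by
      rw [show -n - m = -(n + m) by ring, dvd_neg]
    simp only [Equiv.neg_apply, u, hiff]
    split_ifs <;> simp [ha]
  let B : ℤ → ℂ := fun m => ∑' n : ℤ, (if n < m ∧ k ∣ n - m then c n * a n else 0)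
  have hB' : ∀ m, B m = ∑' n : ℤ, -(if m ≤ n ∧ k ∣ n - m then c n * a n else 0) := by
    intro m
    rw [tsum_neg, eq_neg_iff_add_eq_zero]
    refine Eq.trans ?_ (hvan m)
    simp only [B]
    rw [← (hsumP _).tsum_add (hsumP _)]
    refine tsum_congr fun n => ?_
    by_cases h1 : k ∣ n - m <;> by_cases h2 : n < m
    · simp [h1, h2, not_le.2 h2]
    · simp [h1, h2, not_lt.1 h2]
    · simp [h1]
    · simp [h1]
  have hBrec : ∀ m, B (m + k) - B m = c m * a m := by
    intro m
    simp only [B]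
    rw [← (hsumP _).tsum_sub (hsumP _), ← tsum_ite_eq m (fun n => c n * a n)]
    refine tsum_congr fun n => ?_
    have hiff : k ∣ n - (m + k) ↔ k ∣ n - m := by
      rw [show n - (m + k) = n - m - k by ring]; exact dvd_sub_self_right
    simp only [hiff]
    by_cases h1 : k ∣ n - m
    · by_cases h2 : n = m
      · subst h2
        simp [show 0 < k by omega]
      · have : (n < m + k) ↔ n < m := by
          obtain ⟨t, ht⟩ := h1
          constructor
          · intro h
            have ht1 : t < 1 := by nlinarith
            have ht0 : t ≠ 0 := by
              rintro rfl
              apply h2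
              linarith
            have : t ≤ -1 := by omega
            nlinarith
          · intro h; omega
        simp [this, h2]
    · have h2 : n ≠ m := by rintro rfl; simp at h1
      simp [h1, h2]
  let b : ℤ → ℂ := fun m => B m / c m
  have hbr : Rapid b := by
    intro R hR
    obtain ⟨C, hC⟩ := har R hR
    have hE := EE_summable (DD_nonneg η p k) (norm_pos_iff.2 hp) hp1
    refine ⟨C * ∑' l, EE (DD η p k) ‖p‖ l, fun m => ?_⟩
    have hcm : 0 < ‖c m‖ := norm_pos_iff.2 (hcne m)
    have hterm : ∀ n : ℤ, (m ≤ 0 ∧ n ≤ m) ∨ (0 ≤ m ∧ m ≤ n) →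
        ‖c n * a n‖ ≤ ‖c m‖ * C / R ^ m.natAbs * EE (DD η p k) ‖p‖ (n - m) := by
      intro n h
      have h1 := cc_ratio hη hp hp1 hk h
      have h2 : ‖a n‖ ≤ C / R ^ m.natAbs := by
        rw [le_div_iff₀ (by positivity)]
        refine le_trans ?_ (hC n)
        gcongr ‖a n‖ * ?_
        exact pow_le_pow_right₀ hR (by omega)
      have h3 := (norm_nonneg _).trans h1
      rw [norm_mul]
      calc _ ≤ (‖c m‖ * EE (DD η p k) ‖p‖ (n - m)) * (C / R ^ m.natAbs) := by gcongr
        _ = _ := by ring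
    have hC0 : 0 ≤ C := le_trans (by positivity) (hC 0)
    have hnn : ∀ n : ℤ, 0 ≤ ‖c m‖ * C / R ^ m.natAbs * EE (DD η p k) ‖p‖ (n - m) := by
      intro n
      have := DD_nonneg η p k
      unfold EE
      positivity
    have hhs : HasSum (fun n : ℤ => ‖c m‖ * C / R ^ m.natAbs * EE (DD η p k) ‖p‖ (n - m))
        (‖c m‖ * C / R ^ m.natAbs * ∑' l, EE (DD η p k) ‖p‖ l) :=
by
      have := ((Equiv.subRight m).hasSum_iff (f := EE (DD η p k) ‖p‖)).2 hE.hasSum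
      exact HasSum.mul_left _ this
    have hBm : ‖B m‖ ≤ ‖c m‖ * C / R ^ m.natAbs * ∑' l, EE (DD η p k) ‖p‖ l := by
      rcases le_total m 0 with h | h
      · refine tsum_of_norm_bounded hhs fun n => ?_
        split_ifs with h1
        · exact hterm n (Or.inl ⟨h, h1.1.le⟩)
        · simpa using hnn n
      · rw [hB']
        refine tsum_of_norm_bounded hhs fun n => ?_
        rw [norm_neg]
        split_ifs with h1
        · exact hterm n (Or.inr ⟨h, h1.1⟩)
        · simpa using hnn n
    simp only [b]
    rw [norm_div]
    have hRp : 0 < R ^ m.natAbs := by positivity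
    calc ‖B m‖ / ‖c m‖ * R ^ m.natAbs
        ≤ (‖c m‖ * C / R ^ m.natAbs * ∑' l, EE (DD η p k) ‖p‖ l) / ‖c m‖ * R ^ m.natAbs := by gcongr
      _ = _ := by field_simp
  refine ⟨fun z => ∑' n : ℤ, b n * z ^ n, fun z hz => hbr.differentiableAt hz, fun z hz => ?_⟩
  simp only
  have hqz : q * z ≠ 0 := mul_ne_zero hq hz
  have hs1 := ((Equiv.addRight k).summable_iff.2 (hbr.summable hqz)).mul_left (η ^ (-k) * z ^ (-k))
  rw [← (Equiv.addRight k).tsum_eq (fun n => b n * (q * z) ^ n), ← tsum_mul_left]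
  have hs2 := hbr.summable hz
  refine Eq.trans ?_ (hs1.tsum_sub hs2)
  rw [← (laurent hf hz).tsum_eq]
  refine tsum_congr fun n => ?_
  simp only [Function.comp, Equiv.coe_addRight, b]
  have h1 := hBrec n
  have h2 : a n = (B (n + k) - B n) / c n := by rw [h1]; field_simp [hcne n]
  rw [← ha, h2, hcrec, mul_zpow, zpow_add₀ hz, zpow_neg z]
  have e1 : z ^ k ≠ 0 := zpow_ne_zero _ hz
  have e2 : η ^ (-k) ≠ 0 := zpow_ne_zero _ hη
  have e3 : q ^ (n + k) ≠ 0 := zpow_ne_zero _ hq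
  have e4 := hcne n
  field_simp
end
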